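/- Let G be a matrix in Sp(6,Z) and let s1, t1, s2, t2 be rational numbers with s1 > 0, t1 > 0, s2 > 0 and t2 > 0. If G·(s1·E14 + t1·E25) = (s2·E14 + t2·E25)·G, then {s1, t1} = {s2, t2} as unordered pairs, i.e. either (s1 = s2 and t1 = t2) or (s1 = t2 and t1 = s2); consequently conjugation by G maps the cone {s·E14 + t·E25 : s, t rational, s, t ≥ 0} onto itself. (This is the rigidity of the standard type-I_2 nilpotent cone under the adjoint Sp(6,Z)-action, which implies that the Sp(6,Z)-orbits of the cones σ34, σ63 and σ67 have no non-trivial interior intersections.) -/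

import Mathlib

open Matrix

/-- The standard symplectic form `Q` on `ℚ^6`. -/
def Q6 : Matrix (Fin 6) (Fin 6) ℚ :=
  !![0,0,0,1,0,0;
     0,0,0,0,1,0;
     0,0,0,0,0,1;
     -1,0,0,0,0,0;
     0,-1,0,0,0,0;
     0,0,-1,0,0,0]

/-- `H ∈ Sp(6,ℤ)`: an integer matrix satisfying `Hᵀ·Q·H = Q`. -/
def Sp6Z (H : Matrix (Fin 6) (Fin 6) ℤ) : Prop :=
  (H.map (Int.cast : ℤ → ℚ))ᵀ * Q6 * (H.map (Int.cast : ℤ → ℚ)) = Q6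

/-- The principal congruence subgroup `Γₙ ⊆ Sp(6,ℤ)`. -/
def GammaN (n : ℕ) (H : Matrix (Fin 6) (Fin 6) ℤ) : Prop :=
  Sp6Z H ∧ ∀ i j, (n : ℤ) ∣ (H - 1) i j

def Tm1 : Matrix (Fin 6) (Fin 6) ℤ :=
  !![1,1,0,6,-4,-4;
     0,1,0,4,-8,-4;
     0,0,1,0,-4,0;
     0,0,0,1,0,0;
     0,0,0,-1,1,0;
     0,0,0,0,0,1]

def Tm2 : Matrix (Fin 6) (Fin 6) ℤ :=
  !![1,0,1,2,-2,0;
     0,1,0,-2,-4,0;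
     0,0,1,0,0,0;
     0,0,0,1,0,0;
     0,0,0,0,1,0;
     0,0,0,-1,0,1]

def TC1sq : Matrix (Fin 6) (Fin 6) ℤ :=
  !![1,0,0,0,0,0;
     0,1,0,0,0,0;
     0,0,1,0,0,4;
     0,0,0,1,0,0;
     0,0,0,0,1,0;
     0,0,0,0,0,1]

def Tcon1 : Matrix (Fin 6) (Fin 6) ℤ :=
  !![3,0,0,4,0,0;
     0,1,0,0,0,0;
     0,0,1,0,0,0;
     -1,0,0,-1,0,0;
     0,0,0,0,1,0;
     0,0,0,0,0,1]

def TE2sq : Matrix (Fin 6) (Fin 6) ℤ :=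
  !![1,0,0,0,0,0;
     0,1,4,0,-24,0;
     0,0,1,0,0,0;
     0,0,0,1,0,0;
     0,0,0,0,1,0;
     0,0,2,0,-4,1]

def TE0q : Matrix (Fin 6) (Fin 6) ℤ :=
  !![1,0,0,0,0,0;
     0,1,0,0,0,0;
     8,-4,1,0,0,8;
     -8,4,0,1,0,-8;
     4,-2,0,0,1,4;
     0,0,0,0,0,1]

def Tcon2 : Matrix (Fin 6) (Fin 6) ℤ :=
  !![1,0,0,0,0,0;
     -2,3,-2,0,4,0;
     0,0,1,0,0,0;
     -1,1,-1,1,2,0;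
     1,-1,1,0,-1,0;
     -1,1,-1,0,2,1]

def TC0 : Matrix (Fin 6) (Fin 6) ℤ :=
  !![-1,-1,2,-2,8,-4;
     2,3,-2,-8,4,12;
     0,0,1,0,4,0;
     0,0,1,-3,6,0;
     0,0,0,-1,1,0;
     -1,-1,1,2,2,-3]

/-- The monodromy matrix around the exceptional divisor `D_{(1,-1)}`. -/
def Td11 : Matrix (Fin 6) (Fin 6) ℤ :=
  !![1,0,-1,2,-2,0;
     0,1,0,2,-4,4;
     0,1,-1,-4,-8,-2;
     0,0,0,1,0,0;
     0,0,0,1,1,1;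
     0,0,0,-1,0,-1]

/-- The monodromy matrix around the divisor `D_{(1,0)}`. -/
def Sd10 : Matrix (Fin 6) (Fin 6) ℤ :=
  !![1,-1,0,6,4,0;
     0,1,0,-4,-8,-4;
     0,0,1,-4,-4,0;
     0,0,0,1,0,0;
     0,0,0,1,1,0;
     0,0,0,0,0,1]

def N1 : Matrix (Fin 6) (Fin 6) ℚ :=
  !![0,1,0,14/3,0,-2;
     0,0,0,0,-8,-4;
     0,0,0,-2,-4,0;
     0,0,0,0,0,0;
     0,0,0,-1,0,0;
     0,0,0,0,0,0]

def N2 : Matrix (Fin 6) (Fin 6) ℚ :=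
  !![0,0,1,2,-2,0;
     0,0,0,-2,-4,0;
     0,0,0,0,0,0;
     0,0,0,0,0,0;
     0,0,0,0,0,0;
     0,0,0,-1,0,0]

def N3 : Matrix (Fin 6) (Fin 6) ℚ :=
  !![0,0,0,0,0,0;
     0,0,0,0,0,0;
     0,0,0,0,0,4;
     0,0,0,0,0,0;
     0,0,0,0,0,0;
     0,0,0,0,0,0]

def N4 : Matrix (Fin 6) (Fin 6) ℚ :=
  !![2,0,0,4,0,0;
     0,0,0,0,0,0;
     0,0,0,0,0,0;
     -1,0,0,-2,0,0;
     0,0,0,0,0,0;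
     0,0,0,0,0,0]

def N5 : Matrix (Fin 6) (Fin 6) ℚ :=
  !![0,0,0,0,0,0;
     0,0,4,0,-24,0;
     0,0,0,0,0,0;
     0,0,0,0,0,0;
     0,0,0,0,0,0;
     0,0,2,0,-4,0]

def N6 : Matrix (Fin 6) (Fin 6) ℚ :=
  !![0,0,0,0,0,0;
     0,0,0,0,0,0;
     8,-4,0,0,0,8;
     -8,4,0,0,0,-8;
     4,-2,0,0,0,4;
     0,0,0,0,0,0]

def N7 : Matrix (Fin 6) (Fin 6) ℚ :=
  !![0,0,0,0,0,0;
     -2,2,-2,0,4,0;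
     0,0,0,0,0,0;
     -1,1,-1,0,2,0;
     1,-1,1,0,-2,0;
     -1,1,-1,0,2,0]

def E14 : Matrix (Fin 6) (Fin 6) ℚ :=
  !![0,0,0,1,0,0;
     0,0,0,0,0,0;
     0,0,0,0,0,0;
     0,0,0,0,0,0;
     0,0,0,0,0,0;
     0,0,0,0,0,0]

def E25 : Matrix (Fin 6) (Fin 6) ℚ :=
  !![0,0,0,0,0,0;
     0,0,0,0,1,0;
     0,0,0,0,0,0;
     0,0,0,0,0,0;
     0,0,0,0,0,0;
     0,0,0,0,0,0]

def G34 : Matrix (Fin 6) (Fin 6) ℤ :=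
  !![1,0,0,1,0,0;
     0,0,1,0,0,0;
     0,1,0,0,0,0;
     1,0,0,2,0,0;
     0,0,0,0,0,1;
     0,0,0,0,1,0]

def G63 : Matrix (Fin 6) (Fin 6) ℤ :=
  !![0,0,1,0,-2,0;
     0,0,0,0,1,0;
     1,0,0,0,0,0;
     0,0,0,0,0,1;
     2,-1,0,0,0,2;
     0,0,0,1,2,0]

def G67 : Matrix (Fin 6) (Fin 6) ℤ :=
  !![0,0,0,1,1,0;
     0,0,0,1,2,0;
     0,0,1,2,2,0;
     -2,1,0,0,0,-2;
     1,-1,1,0,-2,0;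
     0,0,0,1,2,1]

/-- If `a, a'` are integers with `s * a = u * a'` for positive `s, u`, then `a * a'` is
nonnegative, `a` and `a'` vanish together, and `a * a' = 1` forces `a = a'` and `s = u`. -/
theorem int_pair_of_pos_smul_eq {a a' : ℤ} {s u : ℚ} (hs : 0 < s) (hu : 0 < u)
    (h : s * a = u * a') :
    0 ≤ a * a' ∧ (a * a' = 0 → a = 0 ∧ a' = 0) ∧ (a * a' = 1 → a' = a ∧ a ≠ 0 ∧ s = u) := by
  have hzero : a = 0 ↔ a' = 0 := by
    constructor <;> rintro rfl <;> simpa [hs.ne', hu.ne'] using h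
  refine ⟨?_, fun h0 ↦ ?_, fun h1 ↦ ?_⟩
  · have : (0 : ℚ) ≤ s * (a * a') := by
      rw [← mul_assoc, h, mul_assoc]
      exact mul_nonneg hu.le (mul_self_nonneg _)
    exact_mod_cast nonneg_of_mul_nonneg_right this hs
  · rcases mul_eq_zero.mp h0 with h0 | h0 <;> tauto
  · rcases Int.mul_eq_one_iff_eq_one_or_neg_one.mp h1 with ⟨rfl, rfl⟩ | ⟨rfl, rfl⟩ <;>
      simpa using h

/-- Integer `2 × 2` blocks `A = (a, b; c, d)` and `D = (a', b'; c', d')` with `Aᵀ * D = 1` and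
`A * diag(s₁, t₁) = diag(s₂, t₂) * D` are equal and are signed permutation matrices. -/
theorem signed_perm_of_diag_intertwining {a b c d a' b' c' d' : ℤ} {s₁ t₁ s₂ t₂ : ℚ}
    (hs₁ : 0 < s₁) (ht₁ : 0 < t₁) (hs₂ : 0 < s₂) (ht₂ : 0 < t₂)
    (ha : s₁ * a = s₂ * a') (hb : t₁ * b = s₂ * b')
    (hc : s₁ * c = t₂ * c') (hd : t₁ * d = t₂ * d')
    (h11 : a * a' + c * c' = 1) (h12 : a * b' + c * d' = 0) (h22 : b * b' + d * d' = 1) :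
    (s₁ = s₂ ∧ t₁ = t₂ ∧ a' = a ∧ d' = d ∧ b = 0 ∧ b' = 0 ∧ c = 0 ∧ c' = 0) ∨
      (s₁ = t₂ ∧ t₁ = s₂ ∧ b' = b ∧ c' = c ∧ a = 0 ∧ a' = 0 ∧ d = 0 ∧ d' = 0) := by
  obtain ⟨a0, az, a1⟩ := int_pair_of_pos_smul_eq hs₁ hs₂ ha
  obtain ⟨b0, bz, b1⟩ := int_pair_of_pos_smul_eq ht₁ hs₂ hb
  obtain ⟨c0, cz, c1⟩ := int_pair_of_pos_smul_eq hs₁ ht₂ hc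
  obtain ⟨d0, dz, d1⟩ := int_pair_of_pos_smul_eq ht₁ ht₂ hd
  have hsplit : a * a' = 1 ∧ c * c' = 0 ∨ a * a' = 0 ∧ c * c' = 1 := by omega
  rcases hsplit with ⟨ha1, hc0⟩ | ⟨ha0, hc1⟩
  · obtain ⟨rfl, rfl⟩ := cz hc0
    obtain ⟨haa, hane, hss⟩ := a1 ha1
    obtain rfl : b' = 0 := by simpa [hane] using h12
    obtain ⟨rfl, -⟩ := bz (by simp)
    obtain ⟨hdd, -, htt⟩ := d1 (by simpa using h22)
    simp [haa, hss, hdd, htt]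
  · obtain ⟨rfl, rfl⟩ := az ha0
    obtain ⟨hcc, hcne, hst⟩ := c1 hc1
    obtain rfl : d' = 0 := by simpa [hcne] using h12
    obtain ⟨rfl, -⟩ := dz (by simp)
    obtain ⟨hbb, -, hts⟩ := b1 (by simpa using h22)
    simp [hcc, hst, hbb, hts]

theorem Sp6Z.isUnit_det {G : Matrix (Fin 6) (Fin 6) ℤ} (hG : Sp6Z G) :
    IsUnit (G.map (Int.cast : ℤ → ℚ)).det := by
  have hQ : Q6 * Q6 = -1 := by
    ext i j
    fin_cases i <;> fin_cases j <;> simp [Q6, Matrix.mul_apply, Fin.sum_univ_six]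
  refine Matrix.isUnit_det_of_left_inverse (B := -(Q6 * (G.map (Int.cast : ℤ → ℚ))ᵀ * Q6)) ?_
  rw [neg_mul, mul_assoc, mul_assoc, ← mul_assoc _ Q6, show _ = Q6 from hG, hQ, neg_neg]

theorem Sp6Z.pairing {G : Matrix (Fin 6) (Fin 6) ℤ} (hG : Sp6Z G) (i j : Fin 6) :
    (G 0 i * G 3 j + G 1 i * G 4 j + G 2 i * G 5 j
      - G 3 i * G 0 j - G 4 i * G 1 j - G 5 i * G 2 j : ℚ) = Q6 i j := by
  have h := congrFun (congrFun hG i) j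
  rw [← h]
  simp [Q6, Matrix.mul_apply, Fin.sum_univ_six]
  ring

theorem smul_E14_add_smul_E25 (s t : ℚ) :
    s • E14 + t • E25 =
      !![0,0,0,s,0,0; 0,0,0,0,t,0; 0,0,0,0,0,0; 0,0,0,0,0,0; 0,0,0,0,0,0; 0,0,0,0,0,0] := by
  ext i j
  fin_cases i <;> fin_cases j <;> simp [E14, E25]

theorem conj_eq_of_mul_eq_mul {n R : Type*} [Fintype n] [DecidableEq n] [CommRing R]
    {A M N : Matrix n n R} (hA : IsUnit A.det) (h : A * M = N * A) : A * M * A⁻¹ = N := by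
  rw [h, Matrix.mul_nonsing_inv_cancel_right A N hA]

theorem mul_smul_E14_add_smul_E25 {A : Matrix (Fin 6) (Fin 6) ℚ} {s t s' t' : ℚ}
    (hcol0 : ∀ i, 2 ≤ i → A i 0 = 0) (hcol1 : ∀ i, 2 ≤ i → A i 1 = 0)
    (hrow3 : ∀ j, j ≠ 3 → j ≠ 4 → A 3 j = 0) (hrow4 : ∀ j, j ≠ 3 → j ≠ 4 → A 4 j = 0)
    (ha : s * A 0 0 = s' * A 3 3) (hb : t * A 0 1 = s' * A 3 4)
    (hc : s * A 1 0 = t' * A 4 3) (hd : t * A 1 1 = t' * A 4 4) :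
    A * (s • E14 + t • E25) = (s' • E14 + t' • E25) * A := by
  rw [smul_E14_add_smul_E25, smul_E14_add_smul_E25]
  ext i j
  fin_cases i <;> fin_cases j <;>
    simp [Matrix.mul_apply, Fin.sum_univ_six, mul_comm _ s, mul_comm _ t, hcol0, hcol1,
      hrow3, hrow4, ha, hb, hc, hd]

/-- Rigidity of the standard type-`I₂` nilpotent cone under the adjoint
`Sp(6,ℤ)`-action: if `G·(s1·E14 + t1·E25) = (s2·E14 + t2·E25)·G` with all parameters
positive, then `{s1, t1} = {s2, t2}` as unordered pairs; consequently conjugation by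
`G` maps the cone `{s·E14 + t·E25 : s, t ≥ 0}` onto itself. -/
theorem stmt19 (G : Matrix (Fin 6) (Fin 6) ℤ) (hG : Sp6Z G)
    (s1 t1 s2 t2 : ℚ) (hs1 : 0 < s1) (ht1 : 0 < t1) (hs2 : 0 < s2) (ht2 : 0 < t2)
    (h : (G.map (Int.cast : ℤ → ℚ)) * (s1 • E14 + t1 • E25)
        = (s2 • E14 + t2 • E25) * (G.map (Int.cast : ℤ → ℚ))) :
    ((s1 = s2 ∧ t1 = t2) ∨ (s1 = t2 ∧ t1 = s2)) ∧
    (fun M => (G.map (Int.cast : ℤ → ℚ)) * M * (G.map (Int.cast : ℤ → ℚ))⁻¹) ''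
        {M | ∃ s t : ℚ, 0 ≤ s ∧ 0 ≤ t ∧ M = s • E14 + t • E25}
      = {M | ∃ s t : ℚ, 0 ≤ s ∧ 0 ≤ t ∧ M = s • E14 + t • E25} := by
  have hu := hG.isUnit_det
  have hent (i j : Fin 6) := congrFun (congrFun h i) j
  simp only [smul_E14_add_smul_E25] at hent
  have hcol0 (i : Fin 6) (hi : 2 ≤ i) : G i 0 = 0 := by
    have := hent i 3
    fin_cases i <;> simp_all [Matrix.mul_apply, Fin.sum_univ_six, hs1.ne']
  have hcol1 (i : Fin 6) (hi : 2 ≤ i) : G i 1 = 0 := by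
    have := hent i 4
    fin_cases i <;> simp_all [Matrix.mul_apply, Fin.sum_univ_six, ht1.ne']
  have hrow3 (j : Fin 6) (h3 : j ≠ 3) (h4 : j ≠ 4) : G 3 j = 0 := by
    have := hent 0 j
    fin_cases j <;> simp_all [Matrix.mul_apply, Fin.sum_univ_six, hs2.ne']
  have hrow4 (j : Fin 6) (h3 : j ≠ 3) (h4 : j ≠ 4) : G 4 j = 0 := by
    have := hent 1 j
    fin_cases j <;> simp_all [Matrix.mul_apply, Fin.sum_univ_six, ht2.ne']
  have ha : s1 * G 0 0 = s2 * G 3 3 := by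
    simpa [Matrix.mul_apply, Fin.sum_univ_six, mul_comm] using hent 0 3
  have hb : t1 * G 0 1 = s2 * G 3 4 := by
    simpa [Matrix.mul_apply, Fin.sum_univ_six, mul_comm] using hent 0 4
  have hc : s1 * G 1 0 = t2 * G 4 3 := by
    simpa [Matrix.mul_apply, Fin.sum_univ_six, mul_comm] using hent 1 3
  have hd : t1 * G 1 1 = t2 * G 4 4 := by
    simpa [Matrix.mul_apply, Fin.sum_univ_six, mul_comm] using hent 1 4
  have h20 := hcol0 2 (by decide)
  have h30 := hcol0 3 (by decide)
  have h40 := hcol0 4 (by decide)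
  have h50 := hcol0 5 (by decide)
  have h21 := hcol1 2 (by decide)
  have h31 := hcol1 3 (by decide)
  have h41 := hcol1 4 (by decide)
  have h51 := hcol1 5 (by decide)
  have p11 : G 0 0 * G 3 3 + G 1 0 * G 4 3 = 1 := by
    have := hG.pairing 0 3
    simp [h20, h30, h40, h50, Q6] at this
    exact_mod_cast this
  have p12 : G 0 0 * G 3 4 + G 1 0 * G 4 4 = 0 := by
    have := hG.pairing 0 4
    simp [h20, h30, h40, h50, Q6] at this
    exact_mod_cast this
  have p22 : G 0 1 * G 3 4 + G 1 1 * G 4 4 = 1 := by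
    have := hG.pairing 1 4
    simp [h21, h31, h41, h51, Q6] at this
    exact_mod_cast this
  rcases signed_perm_of_diag_intertwining hs1 ht1 hs2 ht2 ha hb hc hd p11 p12 p22 with
    ⟨hs, ht, h33, h44, h01, h34, h10, h43⟩ | ⟨hs, ht, h34, h43, h00, h33, h11, h44⟩
  · refine ⟨Or.inl ⟨hs, ht⟩, ?_⟩
    have hconj (s t : ℚ) : G.map (Int.cast : ℤ → ℚ) * (s • E14 + t • E25) *
        (G.map (Int.cast : ℤ → ℚ))⁻¹ = s • E14 + t • E25 := by
      apply conj_eq_of_mul_eq_mul hu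
      apply mul_smul_E14_add_smul_E25 <;>
        simp +contextual [hcol0, hcol1, hrow3, hrow4, h33, h44, h01, h34, h10, h43]
    ext M
    constructor
    · rintro ⟨_, ⟨s, t, h0s, h0t, rfl⟩, rfl⟩
      exact ⟨s, t, h0s, h0t, hconj s t⟩
    · rintro ⟨s, t, h0s, h0t, rfl⟩
      exact ⟨_, ⟨s, t, h0s, h0t, rfl⟩, hconj s t⟩
  · refine ⟨Or.inr ⟨hs, ht⟩, ?_⟩
    have hconj (s t : ℚ) : G.map (Int.cast : ℤ → ℚ) * (s • E14 + t • E25) *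
        (G.map (Int.cast : ℤ → ℚ))⁻¹ = t • E14 + s • E25 := by
      apply conj_eq_of_mul_eq_mul hu
      apply mul_smul_E14_add_smul_E25 <;>
        simp +contextual [hcol0, hcol1, hrow3, hrow4, h34, h43, h00, h33, h11, h44]
    ext M
    constructor
    · rintro ⟨_, ⟨s, t, h0s, h0t, rfl⟩, rfl⟩
      exact ⟨t, s, h0t, h0s, hconj s t⟩
    · rintro ⟨s, t, h0s, h0t, rfl⟩
      exact ⟨_, ⟨t, s, h0t, h0s, rfl⟩, hconj t s⟩
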